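/- Let k be any field, A = k[x_i y_j : i,j = 0,…,n] ⊆ R = k[x_0,…,x_n,y_0,…,y_n], and I = (x_i y_j − x_j y_i : 0 ≤ i < j ≤ n) ⊆ A. For k = 1,…,2n−1 set g_k = Σ_{0 ≤ i < j ≤ n, i+j = k} (x_i y_j − x_j y_i). Then √((g_1,…,g_{2n−1})A) = I; in particular ara_h(I) ≤ 2n−1. -/

import Mathlib

/-!
STATEMENT 5: Let k be any field, `A = k[xᵢyⱼ : i,j = 0,…,n] ⊆ R = k[x₀,…,xₙ,y₀,…,yₙ]`,
and `I = (xᵢyⱼ − xⱼyᵢ : 0 ≤ i < j ≤ n) ⊆ A`.  For `t = 1,…,2n−1` set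
`g_t = Σ_{0 ≤ i < j ≤ n, i+j = t} (xᵢyⱼ − xⱼyᵢ)`.  Then `√((g₁,…,g_{2n−1})A) = I`;
in particular `ara_h(I) ≤ 2n−1`.

Here the `x`'s are the variables indexed by `Sum.inl` and the `y`'s those indexed
by `Sum.inr` in `MvPolynomial (Fin (n+1) ⊕ Fin (n+1)) k`; all the polynomials in
sight are homogeneous, so the bound on the number of homogeneous elements of `A`
generating `I` up to radical is a bound for the homogeneous arithmetical rank.
-/

open MvPolynomial

/-- the variables `x_i` -/
noncomputable abbrev segX {k : Type*} [Field k] {n : ℕ} (i : Fin (n+1)) :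
    MvPolynomial (Fin (n+1) ⊕ Fin (n+1)) k := X (Sum.inl i)

/-- the variables `y_j` -/
noncomputable abbrev segY {k : Type*} [Field k] {n : ℕ} (j : Fin (n+1)) :
    MvPolynomial (Fin (n+1) ⊕ Fin (n+1)) k := X (Sum.inr j)

/-- `A = k[x_i y_j : 0 ≤ i,j ≤ n]`, the homogeneous coordinate ring of the Segre
embedding of `ℙⁿ × ℙⁿ`, as a subalgebra of `k[x₀,…,xₙ,y₀,…,yₙ]`. -/
noncomputable def segreCoordRing (k : Type*) [Field k] (n : ℕ) :
    Subalgebra k (MvPolynomial (Fin (n+1) ⊕ Fin (n+1)) k) :=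
  Algebra.adjoin k (Set.range fun p : Fin (n+1) × Fin (n+1) => segX p.1 * segY p.2)

/-- The ideal `I = (x_i y_j - x_j y_i : 0 ≤ i < j ≤ n)` of `A` defining the diagonal
`Δ(ℙⁿ) ⊆ ℙⁿ × ℙⁿ`. -/
noncomputable def diagonalIdeal (k : Type*) [Field k] (n : ℕ) :
    Ideal (segreCoordRing k n) :=
  Ideal.span {a : segreCoordRing k n | ∃ i j : Fin (n+1), i < j ∧
    (a : MvPolynomial (Fin (n+1) ⊕ Fin (n+1)) k) = segX i * segY j - segX j * segY i}

/-- the polynomial `g_t = Σ_{i<j, i+j=t} (x_i y_j - x_j y_i)` -/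
noncomputable def gPoly (k : Type*) [Field k] (n : ℕ) (t : ℕ) :
    MvPolynomial (Fin (n+1) ⊕ Fin (n+1)) k :=
  ∑ p ∈ Finset.univ.filter
      (fun p : Fin (n+1) × Fin (n+1) => p.1 < p.2 ∧ (p.1 : ℕ) + (p.2 : ℕ) = t),
    (segX p.1 * segY p.2 - segX p.2 * segY p.1)

lemma gPoly_mem (k : Type*) [Field k] (n : ℕ) (t : ℕ) :
    gPoly k n t ∈ segreCoordRing k n := by
  refine Subalgebra.sum_mem _ (fun p _ => sub_mem ?_ ?_) <;>
    exact Algebra.subset_adjoin ⟨(_, _), rfl⟩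

/-- `g_t` as an element of `A`. -/
noncomputable def gElem (k : Type*) [Field k] (n : ℕ) (t : ℕ) : segreCoordRing k n :=
  ⟨gPoly k n t, gPoly_mem k n t⟩

/-- homogeneous arithmetical rank of an ideal of `A`, where an element of `A` is
homogeneous when it is a homogeneous polynomial. -/
noncomputable def araHsub {k : Type*} [Field k] {n : ℕ}
    (I : Ideal (segreCoordRing k n)) : ℕ :=
  sInf {t | ∃ f : Fin t → segreCoordRing k n,
    (∀ i, ∃ d, ((f i : MvPolynomial (Fin (n+1) ⊕ Fin (n+1)) k)).IsHomogeneous d) ∧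
    (Ideal.span (Set.range f)).radical = I.radical}

/-- The product `x_i y_j` as an element of the Segre coordinate ring. -/
noncomputable def segreGen (k : Type*) [Field k] (n : ℕ) (i j : Fin (n+1)) :
    segreCoordRing k n :=
  ⟨segX i * segY j, Algebra.subset_adjoin ⟨(i, j), rfl⟩⟩

/-- The minor `x_i y_j - x_j y_i` as an element of the Segre coordinate ring. -/
noncomputable def segreMinor (k : Type*) [Field k] (n : ℕ) (i j : Fin (n+1)) :
    segreCoordRing k n :=
  segreGen k n i j - segreGen k n j i

lemma segreGen_mul_segreGen (k : Type*) [Field k] (n : ℕ) (a b c d : Fin (n+1)) :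
    segreGen k n a b * segreGen k n c d = segreGen k n a d * segreGen k n c b :=
  Subtype.ext (by simp only [segreGen, MulMemClass.coe_mul]; ring)

/-- The three-term Plücker relation. -/
lemma segreMinor_plucker (k : Type*) [Field k] (n : ℕ) (a b c d : Fin (n+1)) :
    segreMinor k n a d * segreMinor k n b c =
      segreMinor k n a c * segreMinor k n b d - segreMinor k n a b * segreMinor k n c d :=
  Subtype.ext (by
    simp only [segreMinor, segreGen, MulMemClass.coe_mul, AddSubgroupClass.coe_sub]
    ring)

lemma segreMinor_mem_diagonalIdeal (k : Type*) [Field k] (n : ℕ) {i j : Fin (n+1)}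
    (h : i < j) : segreMinor k n i j ∈ diagonalIdeal k n :=
  Ideal.subset_span ⟨i, j, h, rfl⟩

lemma diagonalIdeal_le (k : Type*) [Field k] (n : ℕ) {J : Ideal (segreCoordRing k n)}
    (h : ∀ i j : Fin (n+1), i < j → segreMinor k n i j ∈ J) : diagonalIdeal k n ≤ J := by
  refine Ideal.span_le.2 ?_
  rintro a ⟨i, j, hij, ha⟩
  rw [show a = segreMinor k n i j from Subtype.ext ha]
  exact h i j hij

lemma gElem_eq_sum (k : Type*) [Field k] (n t : ℕ) :
    gElem k n t = ∑ p ∈ Finset.univ.filter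
      (fun p : Fin (n+1) × Fin (n+1) => p.1 < p.2 ∧ (p.1 : ℕ) + (p.2 : ℕ) = t),
      segreMinor k n p.1 p.2 := by
  refine Subtype.ext ?_
  rw [AddSubmonoidClass.coe_finsetSum]
  rfl

lemma gElem_mem_diagonalIdeal (k : Type*) [Field k] (n t : ℕ) :
    gElem k n t ∈ diagonalIdeal k n := by
  rw [gElem_eq_sum]
  exact Ideal.sum_mem _ fun p hp =>
    segreMinor_mem_diagonalIdeal k n (Finset.mem_filter.1 hp).2.1

lemma gPoly_isHomogeneous (k : Type*) [Field k] (n t : ℕ) :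
    (gPoly k n t).IsHomogeneous 2 :=
  IsHomogeneous.sum _ _ _ fun _ _ =>
    ((isHomogeneous_X k _).mul (isHomogeneous_X k _)).sub
      ((isHomogeneous_X k _).mul (isHomogeneous_X k _))

/-- A radical ideal containing all the `g_t` contains all the minors. -/
lemma segreMinor_mem_of_gElem_mem (k : Type*) [Field k] (n : ℕ)
    {J : Ideal (segreCoordRing k n)} (hJ : J.IsRadical)
    (hg : ∀ t : Fin (2*n - 1), gElem k n (t + 1) ∈ J) (t : ℕ) :
    ∀ i j : Fin (n+1), i < j → (i : ℕ) + j = t → segreMinor k n i j ∈ J := by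
  induction t using Nat.strong_induction_on with
  | _ t ih =>
    have nested : ∀ a b c d : Fin (n+1), a < b → b < c → c < d → (a : ℕ) + d = t →
        segreMinor k n a d * segreMinor k n b c ∈ J := by
      intro a b c d hab hbc hcd ht
      rw [segreMinor_plucker]
      exact sub_mem
        (Ideal.mul_mem_right _ _ (ih (a + c) (by omega) a c (hab.trans hbc) rfl))
        (Ideal.mul_mem_right _ _ (ih (a + b) (by omega) a b hab rfl))
    intro i j hij ht
    have hmem : gElem k n t ∈ J := by
      have := hg ⟨t - 1, by omega⟩
      rwa [show t - 1 + 1 = t by omega] at this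
    refine hJ ⟨2, ?_⟩
    have hprod := J.mul_mem_left (segreMinor k n i j) hmem
    rw [gElem_eq_sum, ← Finset.add_sum_erase _ _ (a := (i, j)) (by simp [hij, ht]), mul_add,
      Finset.mul_sum] at hprod
    rw [pow_two]
    refine (Ideal.add_mem_iff_left _ (Ideal.sum_mem _ ?_)).1 hprod
    rintro ⟨a, b⟩ hp
    simp only [Finset.mem_erase, Finset.mem_filter, ne_eq, Prod.mk.injEq, Finset.mem_univ,
      true_and] at hp
    obtain ⟨hne, hab, hs⟩ := hp
    rcases lt_trichotomy a i with h | h | h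
    · rw [mul_comm]
      exact nested a i j b h hij (by omega) hs
    · exact absurd ⟨h, by omega⟩ hne
    · exact nested i a b j h hab (by omega) ht

/-- The product of `u` over consecutive pairs of a list; zero if the length is odd. -/
def pairProd {ι B : Type*} [CommRing B] (u : ι → ι → B) : List ι → B
  | [] => 1
  | [_] => 0
  | a :: b :: l => u a b * pairProd u l

lemma pairProd_perm {ι B : Type*} [CommRing B] {u : ι → ι → B} (hu : ∀ a b, u a b = u b a)
    (hu' : ∀ a b c d, u a b * u c d = u a d * u c b) {l l' : List ι} (h : l.Perm l') :
    pairProd u l = pairProd u l' := by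
  suffices pairProd u l = pairProd u l' ∧ ∀ a, pairProd u (a :: l) = pairProd u (a :: l') from
    this.1
  induction h with
  | nil => exact ⟨rfl, fun _ => rfl⟩
  | cons x _ ih => exact ⟨ih.2 x, fun a => by simp only [pairProd, ih.1]⟩
  | swap x y l =>
    refine ⟨by simp only [pairProd, hu x y], fun c => ?_⟩
    cases l with
    | nil => simp [pairProd]
    | cons d l =>
      simp only [pairProd]
      rw [← mul_assoc, ← mul_assoc, hu x d, hu' c y d x, hu d y]
  | trans _ _ ih₁ ih₂ => exact ⟨ih₁.1.trans ih₂.1, fun a => (ih₁.2 a).trans (ih₂.2 a)⟩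

/-- The restriction to the diagonal, sending both `x_i` and `y_i` to `z_i`. -/
noncomputable def diagonalRestriction (k : Type*) [Field k] (n : ℕ) :
    MvPolynomial (Fin (n+1) ⊕ Fin (n+1)) k →ₐ[k] MvPolynomial (Fin (n+1)) k :=
  rename (Sum.elim id id)

/-- The linear map `k[z] → A / I` sending a monomial of even degree to the class of
any of its lifts to the Segre coordinate ring. -/
noncomputable def diagonalLift (k : Type*) [Field k] (n : ℕ) :
    MvPolynomial (Fin (n+1)) k →ₗ[k] segreCoordRing k n ⧸ diagonalIdeal k n :=
  (basisMonomials (Fin (n+1)) k).constr k fun m =>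
    pairProd (fun i j => Ideal.Quotient.mk (diagonalIdeal k n) (segreGen k n i j))
      (Finsupp.toMultiset m).toList

lemma mk_segreGen_comm (k : Type*) [Field k] (n : ℕ) (i j : Fin (n+1)) :
    Ideal.Quotient.mk (diagonalIdeal k n) (segreGen k n i j) =
      Ideal.Quotient.mk (diagonalIdeal k n) (segreGen k n j i) := by
  rcases lt_trichotomy i j with h | h | h
  · exact Ideal.Quotient.eq.2 (segreMinor_mem_diagonalIdeal k n h)
  · rw [h]
  · exact (Ideal.Quotient.eq.2 (segreMinor_mem_diagonalIdeal k n h)).symm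

lemma diagonalLift_prod_X (k : Type*) [Field k] (n : ℕ) (l : List (Fin (n+1))) :
    diagonalLift k n (l.map X).prod =
      pairProd (fun i j => Ideal.Quotient.mk (diagonalIdeal k n) (segreGen k n i j)) l := by
  have hl : (l.map X).prod =
      basisMonomials (Fin (n+1)) k (Multiset.toFinsupp (l : Multiset _)) := by
    rw [coe_basisMonomials]
    induction l with
    | nil => simp
    | cons a l ih =>
      rw [List.map_cons, List.prod_cons, ih, ← Multiset.cons_coe, ← Multiset.singleton_add, map_add,
        Multiset.toFinsupp_singleton, X, monomial_mul, one_mul]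
  rw [hl, diagonalLift, Module.Basis.constr_basis]
  refine pairProd_perm (mk_segreGen_comm k n) (fun a b c d => ?_) ?_
  · rw [← map_mul, segreGen_mul_segreGen, map_mul]
  · rw [← Multiset.coe_eq_coe, Multiset.coe_toList, Multiset.toFinsupp_toMultiset]

/-- The class modulo `I` of an element of `A` is determined by its restriction to the diagonal. -/
lemma mk_eq_diagonalLift (k : Type*) [Field k] (n : ℕ) (a : segreCoordRing k n) :
    Ideal.Quotient.mk (diagonalIdeal k n) a =
      diagonalLift k n (diagonalRestriction k n a) := by
  obtain ⟨f, hf⟩ := a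
  suffices ∃ h : f ∈ segreCoordRing k n, Ideal.Quotient.mk (diagonalIdeal k n) ⟨f, h⟩ =
      diagonalLift k n (diagonalRestriction k n f) from this.2
  have hspan := hf
  rw [segreCoordRing, ← Subalgebra.mem_toSubmodule, Algebra.adjoin_eq_span] at hspan
  clear hf
  induction hspan using Submodule.span_induction with
  | zero => exact ⟨zero_mem _, by rw [map_zero, map_zero]; exact map_zero _⟩
  | add f g _ _ hf hg =>
    obtain ⟨hf, hf'⟩ := hf
    obtain ⟨hg, hg'⟩ := hg
    refine ⟨add_mem hf hg, ?_⟩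
    rw [map_add, map_add, ← hf', ← hg', ← map_add]
    rfl
  | smul c f _ hf =>
    obtain ⟨hf, hf'⟩ := hf
    refine ⟨Subalgebra.smul_mem _ hf c, ?_⟩
    rw [map_smul, map_smul, ← hf']
    rfl
  | mem f hf =>
    suffices ∃ (h : f ∈ segreCoordRing k n) (l : List (Fin (n+1))),
        diagonalRestriction k n f = (l.map X).prod ∧
        Ideal.Quotient.mk (diagonalIdeal k n) ⟨f, h⟩ = pairProd
          (fun i j => Ideal.Quotient.mk (diagonalIdeal k n) (segreGen k n i j)) l by
      obtain ⟨h, l, h₁, h₂⟩ := this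
      exact ⟨h, by rw [h₁, h₂, diagonalLift_prod_X]⟩
    induction hf using Submonoid.closure_induction_left with
    | one => exact ⟨one_mem _, [], by simp, map_one _⟩
    | mul_left g hg f _ ih =>
      obtain ⟨⟨i, j⟩, rfl⟩ := hg
      obtain ⟨h, l, h₁, h₂⟩ := ih
      refine ⟨mul_mem (segreGen k n i j).2 h, i :: j :: l, ?_, ?_⟩
      · rw [map_mul, h₁]
        simp [diagonalRestriction, mul_assoc]
      · rw [pairProd, ← h₂, ← map_mul]
        rfl

lemma diagonalIdeal_isRadical (k : Type*) [Field k] (n : ℕ) :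
    (diagonalIdeal k n).IsRadical := by
  let φ := (diagonalRestriction k n).comp (segreCoordRing k n).val
  have hker : diagonalIdeal k n = RingHom.ker φ := by
    refine le_antisymm (diagonalIdeal_le k n fun i j _ => ?_) fun a ha => ?_
    · simp [φ, RingHom.mem_ker, segreMinor, segreGen, diagonalRestriction, mul_comm]
    · rw [← Ideal.Quotient.eq_zero_iff_mem, mk_eq_diagonalLift]
      rw [show diagonalRestriction k n a = 0 from ha, map_zero]
  rw [hker]
  exact (RingHom.ker_isPrime φ).isRadical

theorem segre_diagonal_explicit_generators (k : Type*) [Field k] (n : ℕ) (hn : 1 ≤ n) :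
    (Ideal.span (Set.range fun t : Fin (2*n - 1) => gElem k n (t + 1))).radical
        = diagonalIdeal k n ∧
      araHsub (diagonalIdeal k n) ≤ 2*n - 1 := by
  have hrad : (Ideal.span (Set.range fun t : Fin (2*n - 1) => gElem k n (t + 1))).radical
      = diagonalIdeal k n := by
    refine le_antisymm ((diagonalIdeal_isRadical k n).radical_le_iff.2 (Ideal.span_le.2 ?_))
      (diagonalIdeal_le k n fun i j hij => ?_)
    · rintro _ ⟨t, rfl⟩
      exact gElem_mem_diagonalIdeal k n _
    · exact segreMinor_mem_of_gElem_mem k n (Ideal.radical_isRadical _)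
        (fun t => Ideal.le_radical (Ideal.subset_span (Set.mem_range_self t))) _ i j hij rfl
  exact ⟨hrad, Nat.sInf_le ⟨fun t => gElem k n (t + 1),
    fun t => ⟨2, gPoly_isHomogeneous k n (t + 1)⟩,
    hrad.trans (diagonalIdeal_isRadical k n).radical.symm⟩⟩
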